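/- arXiv:2405.16775 — 2 statements merged into one kernel-verified Lean document; each statement's English description precedes it below -/
import Mathlib

section
/- (Reflection positivity, Proposition 2.3 first part.) Let λ > 0 and let f : ℝ³ → ℝ² ⊗ ℝ^d be smooth compactly supported with supp f ⊂ ℝ³₊. Then ⟨A(f)A(rRf)⟩₀ = (1/(2λ)) ‖π(f)‖²_{L²(ℝ²;ℝ²⊗ℝ^d)}; in particular ⟨A(f)A(rRf)⟩₀ ≥ 0. -/
open MeasureTheory

/-- The function `u`: `u(s) = 1/2` for `s ≥ 0`, `u(s) = -1/2` for `s < 0`. -/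
noncomputable def uStep (s : ℝ) : ℝ := if 0 ≤ s then 1/2 else -1/2

/-- The antisymmetric symbol `ε_{ij}` on `Fin 2`, with `ε₀₁ = 1`. -/
noncomputable def epsSym : Fin 2 → Fin 2 → ℝ :=
  fun i j => (!![0, 1; -1, 0] : Matrix (Fin 2) (Fin 2) ℝ) i j

/-- The propagator pairing `⟨A(f)A(g)⟩₀`. -/
noncomputable def pairing (d : ℕ) (lam : ℝ)
    (f g : (Fin 2 → ℝ) × ℝ → Fin 2 → Fin d → ℝ) : ℝ :=
  -lam⁻¹ * ∑ α : Fin d, ∑ i : Fin 2, ∑ j : Fin 2, epsSym i j *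
    ∫ p : ((Fin 2 → ℝ) × ℝ × ℝ),
      f (p.1, p.2.1) i α * g (p.1, p.2.2) j α * uStep (p.2.1 - p.2.2)

/-- `π(f)(x) = ∫ f(x,t) dt`, componentwise. -/
noncomputable def piMap (d : ℕ) (f : (Fin 2 → ℝ) × ℝ → Fin 2 → Fin d → ℝ) :
    (Fin 2 → ℝ) → Fin 2 → Fin d → ℝ :=
  fun x i α => ∫ t : ℝ, f (x, t) i α

/-- The rotation `r`: `(r f)¹ = f²`, `(r f)² = −f¹`. -/
def rMap (d : ℕ) (f : (Fin 2 → ℝ) × ℝ → Fin 2 → Fin d → ℝ) :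
    (Fin 2 → ℝ) × ℝ → Fin 2 → Fin d → ℝ :=
  fun p => ![f p 1, -(f p 0)]

/-- The `L²(ℝ²; ℝ² ⊗ ℝ^d)` inner product. -/
noncomputable def l2Inner (d : ℕ) (F G : (Fin 2 → ℝ) → Fin 2 → Fin d → ℝ) : ℝ :=
  ∫ x : Fin 2 → ℝ, ∑ i : Fin 2, ∑ α : Fin d, F x i α * G x i α


/-- The reflection `R`: `(R f)(x,t) = f(x,−t)`. -/
def RMap (d : ℕ) (f : (Fin 2 → ℝ) × ℝ → Fin 2 → Fin d → ℝ) :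
    (Fin 2 → ℝ) × ℝ → Fin 2 → Fin d → ℝ :=
  fun p => f (p.1, -p.2)

/-- For a continuous compactly supported `h`, the function `(x, t, s) ↦ h (x, t) * h (x, -s)` is
integrable. -/
theorem integrable_mul_reflect (h : (Fin 2 → ℝ) × ℝ → ℝ) (hc : Continuous h)
    (hs : HasCompactSupport h) :
    Integrable (fun p : (Fin 2 → ℝ) × ℝ × ℝ => h (p.1, p.2.1) * h (p.1, -p.2.2)) := by
  refine Continuous.integrable_of_hasCompactSupport (by fun_prop) ?_
  have hK : IsCompact ((fun q : ((Fin 2 → ℝ) × ℝ) × ((Fin 2 → ℝ) × ℝ) =>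
      (q.1.1, q.1.2, -q.2.2)) '' (tsupport h ×ˢ tsupport h)) :=
    (hs.isCompact.prod hs.isCompact).image (by fun_prop)
  refine HasCompactSupport.of_support_subset_isCompact hK ?_
  rintro ⟨x, t, s⟩ hp
  refine ⟨((x, t), (x, -s)), ⟨subset_tsupport h (left_ne_zero_of_mul hp),
    subset_tsupport h (right_ne_zero_of_mul hp)⟩, by simp⟩

theorem integral_mul_reflect (h : (Fin 2 → ℝ) × ℝ → ℝ) (x : Fin 2 → ℝ) :
    ∫ q : ℝ × ℝ, h (x, q.1) * h (x, -q.2) = (∫ t, h (x, t)) * ∫ t, h (x, t) := by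
  rw [Measure.volume_eq_prod, integral_prod_mul (fun t => h (x, t)) (fun t => h (x, -t)),
    integral_neg_eq_self (fun t => h (x, t))]

/-- The pairing integral of `h` with its reflection, when `h` lives at positive times. -/
theorem integral_mul_reflect_mul_uStep (h : (Fin 2 → ℝ) × ℝ → ℝ) (hc : Continuous h)
    (hs : HasCompactSupport h) (hpos : ∀ p, h p ≠ 0 → 0 < p.2) :
    ∫ p : (Fin 2 → ℝ) × ℝ × ℝ, h (p.1, p.2.1) * h (p.1, -p.2.2) * uStep (p.2.1 - p.2.2) =
      (1 / 2) * ∫ x, (∫ t, h (x, t)) * ∫ t, h (x, t) := by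
  have hu : ∀ p : (Fin 2 → ℝ) × ℝ × ℝ,
      h (p.1, p.2.1) * h (p.1, -p.2.2) * uStep (p.2.1 - p.2.2) =
        (1 / 2) * (h (p.1, p.2.1) * h (p.1, -p.2.2)) := by
    rintro ⟨x, t, s⟩
    by_cases h1 : h (x, t) = 0
    · simp [h1]
    by_cases h2 : h (x, -s) = 0
    · simp [h2]
    have ht : 0 < t := hpos _ h1
    have hs' : 0 < -s := hpos _ h2
    have : 0 ≤ t - s := by linarith
    simp only [uStep, if_pos this]
    ring
  simp_rw [hu, integral_const_mul]
  rw [Measure.volume_eq_prod, integral_prod _ (integrable_mul_reflect h hc hs)]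
  simp_rw [integral_mul_reflect]

theorem integrable_integral_mul_integral (h : (Fin 2 → ℝ) × ℝ → ℝ) (hc : Continuous h)
    (hs : HasCompactSupport h) :
    Integrable (fun x => (∫ t, h (x, t)) * ∫ t, h (x, t)) := by
  simpa only [integral_mul_reflect] using (integrable_mul_reflect h hc hs).integral_prod_left

/-- Reflection positivity: for `λ > 0` and `supp f ⊂ ℝ³₊`,
`⟨A(f)A(rRf)⟩₀ = (1/(2λ)) ‖π(f)‖²_{L²}`; in particular it is nonnegative. -/
theorem reflection_positivity
    (d : ℕ) (hd : 1 ≤ d) (lam : ℝ) (hlam : 0 < lam)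
    (f : (Fin 2 → ℝ) × ℝ → Fin 2 → Fin d → ℝ)
    (hf : ContDiff ℝ (⊤ : ℕ∞) f) (hfc : HasCompactSupport f)
    (hfs : tsupport f ⊆ {p : (Fin 2 → ℝ) × ℝ | 0 < p.2}) :
    pairing d lam f (rMap d (RMap d f)) = (1 / (2 * lam)) * l2Inner d (piMap d f) (piMap d f) ∧
      0 ≤ pairing d lam f (rMap d (RMap d f)) := by
  have hc : ∀ i α, Continuous fun p => f p i α := fun i α =>
    (continuous_apply α).comp ((continuous_apply i).comp hf.continuous)
  have hs : ∀ i α, HasCompactSupport fun p => f p i α := fun i α =>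
    hfc.comp_left (g := fun v : Fin 2 → Fin d → ℝ => v i α) rfl
  have hpos : ∀ i α p, f p i α ≠ 0 → 0 < p.2 := fun i α p hp =>
    hfs (subset_tsupport f fun h0 => hp (by simp [h0]))
  have key : pairing d lam f (rMap d (RMap d f)) =
      (1 / (2 * lam)) * l2Inner d (piMap d f) (piMap d f) := by
    have hl : l2Inner d (piMap d f) (piMap d f) =
        ∑ α, ∑ i, ∫ x, (∫ t, f (x, t) i α) * ∫ t, f (x, t) i α := by
      have hint i α := integrable_integral_mul_integral _ (hc i α) (hs i α)
      simp only [l2Inner, piMap]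
      rw [integral_finsetSum _ fun i _ => integrable_finsetSum _ fun α _ => hint i α,
        Finset.sum_comm]
      exact Finset.sum_congr rfl fun i _ => integral_finsetSum _ fun α _ => hint i α
    rw [hl, pairing, Finset.mul_sum, Finset.mul_sum]
    refine Finset.sum_congr rfl fun α _ => ?_
    have hI i := integral_mul_reflect_mul_uStep _ (hc i α) (hs i α) (hpos i α)
    simp only [Fin.sum_univ_two, epsSym, rMap, RMap, Matrix.of_apply, Matrix.cons_val_zero,
      Matrix.cons_val_one, Pi.neg_apply, mul_neg, neg_mul, integral_neg, hI]
    field_simp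
    ring
  refine ⟨key, key ▸ mul_nonneg (by positivity) (integral_nonneg fun x => ?_)⟩
  exact Finset.sum_nonneg fun i _ => Finset.sum_nonneg fun α _ => mul_self_nonneg _
end

section
/- Let f, g : ℝ³ → ℝ² ⊗ ℝ^d be smooth compactly supported with supp f ⊂ ℝ³₊ and supp g ⊂ ℝ³₊. Then ⟨A(f)A(g)⟩₀ = −⟨A(rRf)A(rRg)⟩₀; that is, the propagator pairing changes sign under the combined reflection-rotation rR, so Wick ordering is not reflection invariant. -/
open MeasureTheory

theorem uStep_neg {s : ℝ} (hs : s ≠ 0) : uStep (-s) = -uStep s := by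
  rcases hs.lt_or_gt with h | h <;> simp [uStep, h.le, h.not_ge] <;> norm_num

/-- In `ℝ² × ℝ × ℝ`, almost every point has distinct time coordinates. -/
theorem ae_time_sub_ne_zero :
    ∀ᵐ p : (Fin 2 → ℝ) × ℝ × ℝ, p.2.1 - p.2.2 ≠ 0 := by
  let L : (Fin 2 → ℝ) × ℝ × ℝ →ₗ[ℝ] ℝ :=
    (LinearMap.fst ℝ ℝ ℝ - LinearMap.snd ℝ ℝ ℝ) ∘ₗ LinearMap.snd ℝ (Fin 2 → ℝ) (ℝ × ℝ)
  have hL : LinearMap.ker L ≠ ⊤ := by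
    intro h
    have h1 : ((0, 1, 0) : (Fin 2 → ℝ) × ℝ × ℝ) ∈ LinearMap.ker L := h ▸ Submodule.mem_top
    simp [L] at h1
  have : (volume : Measure (ℝ × ℝ)).IsAddHaarMeasure := Measure.prod.instIsAddHaarMeasure _ _
  have : (volume : Measure ((Fin 2 → ℝ) × ℝ × ℝ)).IsAddHaarMeasure :=
    Measure.prod.instIsAddHaarMeasure _ _
  have h0 := Measure.addHaar_submodule (volume : Measure ((Fin 2 → ℝ) × ℝ × ℝ)) _ hL
  rw [ae_iff]
  convert h0 using 2
  ext p
  simp [L]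

/-- Reversing both times flips the sign of an integral against `uStep` of their difference. -/
theorem integral_time_reversal_mul_uStep (a b : (Fin 2 → ℝ) × ℝ → ℝ) :
    ∫ p : (Fin 2 → ℝ) × ℝ × ℝ,
        a (p.1, -p.2.1) * b (p.1, -p.2.2) * uStep (p.2.1 - p.2.2) =
      -∫ p : (Fin 2 → ℝ) × ℝ × ℝ, a (p.1, p.2.1) * b (p.1, p.2.2) * uStep (p.2.1 - p.2.2) := by
  let e : (Fin 2 → ℝ) × ℝ × ℝ ≃ᵐ (Fin 2 → ℝ) × ℝ × ℝ :=
    (MeasurableEquiv.refl _).prodCongr ((MeasurableEquiv.neg ℝ).prodCongr (MeasurableEquiv.neg ℝ))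
  have he : MeasurePreserving e volume volume :=
    (MeasurePreserving.id volume).prod
      ((Measure.measurePreserving_neg volume).prod (Measure.measurePreserving_neg volume))
  rw [← integral_neg, ← he.integral_comp' (fun p => -(a (p.1, p.2.1) * b (p.1, p.2.2) *
    uStep (p.2.1 - p.2.2)))]
  refine integral_congr_ae ?_
  filter_upwards [ae_time_sub_ne_zero] with p hp
  have hep : e p = (p.1, -p.2.1, -p.2.2) := rfl
  rw [hep]
  dsimp only
  rw [show -p.2.1 - -p.2.2 = -(p.2.1 - p.2.2) by ring, uStep_neg hp]
  ring

/-- For `f, g` supported in `ℝ³₊`, the propagator pairing changes sign under the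
combined reflection-rotation `rR`: `⟨A(f)A(g)⟩₀ = −⟨A(rRf)A(rRg)⟩₀`. -/
theorem pairing_sign_change_under_rR
    (d : ℕ) (hd : 1 ≤ d) (lam : ℝ) (hlam : lam ≠ 0)
    (f g : (Fin 2 → ℝ) × ℝ → Fin 2 → Fin d → ℝ)
    (hf : ContDiff ℝ (⊤ : ℕ∞) f) (hfc : HasCompactSupport f)
    (hg : ContDiff ℝ (⊤ : ℕ∞) g) (hgc : HasCompactSupport g)
    (hfs : tsupport f ⊆ {p : (Fin 2 → ℝ) × ℝ | 0 < p.2})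
    (hgs : tsupport g ⊆ {p : (Fin 2 → ℝ) × ℝ | 0 < p.2}) :
    pairing d lam f g = -pairing d lam (rMap d (RMap d f)) (rMap d (RMap d g)) := by
  unfold pairing
  rw [← mul_neg, ← Finset.sum_neg_distrib]
  congr 1
  refine Finset.sum_congr rfl fun α _ => ?_
  have h01 := integral_time_reversal_mul_uStep (fun p => f p 1 α) (fun p => g p 0 α)
  have h10 := integral_time_reversal_mul_uStep (fun p => f p 0 α) (fun p => g p 1 α)
  simp [Fin.sum_univ_two, epsSym, rMap, RMap, integral_neg, h01, h10]
end
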